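/- Let n≥1 and let a_1,…,a_n be positive integers. Then Ehr_{q,q^{−1}}(F_{K_{n+1}}(a)) = q^{−F} [a_n]_{q^{n+1}} ∏_{i=1}^{n−1} [(i+1)a_i + a_{i+1} + a_{i+2} + ⋯ + a_n]_q as Laurent polynomials in q, where F = Σ_{i=1}^n i·a_i − n and K_{n+1} is the complete graph on vertices {0,1,…,n}. -/

import Mathlib

open Finset Polynomial

namespace ThresholdFlow

/-- A threshold graph on `{0,…,n}` labeled by reverse degree sequence: whenever `i > j` are
adjacent and `i' ≤ i`, `j' ≤ j`, `i' ≠ j'`, then `i'` and `j'` are adjacent. -/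
def IsThreshold (n : ℕ) (G : SimpleGraph (Fin (n+1))) : Prop :=
  ∀ i j i' j' : Fin (n+1), j < i → G.Adj i j → i' ≤ i → j' ≤ j → i' ≠ j' → G.Adj i' j'

/-- An integer `a`-flow on `G`: nonnegative integers on the edges of `G` (oriented from the
larger endpoint `i` to the smaller endpoint `j`, recorded as `f i j`), with net flow `a i`
at every vertex `i ≠ 0`. -/
def IsFlow (n : ℕ) (G : SimpleGraph (Fin (n+1))) (a : Fin (n+1) → ℕ)
    (f : Fin (n+1) → Fin (n+1) → ℕ) : Prop :=
  (∀ i j, f i j ≠ 0 → j < i ∧ G.Adj i j) ∧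
  (∀ i : Fin (n+1), i ≠ 0 → ∑ j, f i j = a i + ∑ j, f j i)

/-- The number of positive entries of a flow. -/
def posCount (n : ℕ) (f : Fin (n+1) → Fin (n+1) → ℕ) : ℕ :=
  (Finset.univ.filter fun pr : Fin (n+1) × Fin (n+1) => 0 < f pr.1 pr.2).card

/-- `[b]_q = 1 + q + ⋯ + q^(b-1)` as a polynomial in `ℤ[q]`. -/
noncomputable def qnat (b : ℕ) : Polynomial ℤ := ∑ k ∈ Finset.range b, X ^ k

/-- `Ehr_{q,1}(F_G(a))`: the sum over integer `a`-flows with exactly `n` positive entries of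
`∏_{e : f(e) > 0} [f(e)]_q`. -/
noncomputable def Ehr1 (n : ℕ) (G : SimpleGraph (Fin (n+1))) (a : Fin (n+1) → ℕ) :
    Polynomial ℤ :=
  ∑ᶠ f ∈ {f | IsFlow n G a f ∧ posCount n f = n},
    ∏ i, ∏ j, if 0 < f i j then qnat (f i j) else 1

/-- `Ehr_{q,0}(F_G(a))`: the sum over all integer `a`-flows of
`(q-1)^(s(f)-n) ∏_{e : f(e) > 0} q^(f(e)-1)`. -/
noncomputable def Ehr0 (n : ℕ) (G : SimpleGraph (Fin (n+1))) (a : Fin (n+1) → ℕ) :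
    Polynomial ℤ :=
  ∑ᶠ f ∈ {f | IsFlow n G a f},
    (X - 1) ^ (posCount n f - n) * ∏ i, ∏ j, if 0 < f i j then X ^ (f i j - 1) else 1

/-- `Ehr_{1,1}(F_G(a))`: the sum over integer `a`-flows with exactly `n` positive entries of
the product of the positive entries. -/
noncomputable def Ehr11 (n : ℕ) (G : SimpleGraph (Fin (n+1))) (a : Fin (n+1) → ℕ) : ℕ :=
  ∑ᶠ f ∈ {f | IsFlow n G a f ∧ posCount n f = n},
    ∏ i, ∏ j, if 0 < f i j then f i j else 1

/-- A spanning tree of `G` rooted at `0`, encoded by its parent function `p`: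
`p 0 = 0`, each `i ≠ 0` is adjacent in `G` to its parent `p i`, and iterating the parent
function from any vertex reaches the root `0`. -/
def IsSpanTree (n : ℕ) (G : SimpleGraph (Fin (n+1))) (p : Fin (n+1) → Fin (n+1)) : Prop :=
  p 0 = 0 ∧ (∀ i, i ≠ 0 → G.Adj i (p i)) ∧ ∀ i, ∃ k, p^[k] i = 0

/-- `j` is a descendant of `i` in the rooted tree with parent function `p`
(in particular every vertex is a descendant of itself). -/
def Desc (n : ℕ) (p : Fin (n+1) → Fin (n+1)) (i j : Fin (n+1)) : Prop :=
  ∃ k, p^[k] j = i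

/-- The set of inversions of the rooted tree `p`: pairs `(i,j)` with `i > j`, `i ≠ 0` and
`j` a descendant of `i`. -/
def invSet (n : ℕ) (p : Fin (n+1) → Fin (n+1)) : Set (Fin (n+1) × Fin (n+1)) :=
  {pr | pr.2 < pr.1 ∧ pr.1 ≠ 0 ∧ Desc n p pr.1 pr.2}

/-- The number of inversions of the rooted tree `p`. -/
noncomputable def treeInv (n : ℕ) (p : Fin (n+1) → Fin (n+1)) : ℕ := (invSet n p).ncard

/-- A rooted spanning tree is increasing if it has no inversions. -/
def IsIncr (n : ℕ) (p : Fin (n+1) → Fin (n+1)) : Prop := invSet n p = ∅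

/-- `δ_T(i)`: the number of descendants of `i` (including `i` itself). -/
noncomputable def delta (n : ℕ) (p : Fin (n+1) → Fin (n+1)) (i : Fin (n+1)) : ℕ :=
  Set.ncard {j | Desc n p i j}

/-- `δ_T^a(i) = Σ_j a_j`, summed over the descendants `j` of `i` (including `i` itself). -/
noncomputable def deltaA (n : ℕ) (a : Fin (n+1) → ℕ) (p : Fin (n+1) → Fin (n+1))
    (i : Fin (n+1)) : ℕ :=
  ∑ᶠ j ∈ {j | Desc n p i j}, a j

/-- The degree `d_i` of vertex `i` in `G`. -/
noncomputable def deg (n : ℕ) (G : SimpleGraph (Fin (n+1))) (i : Fin (n+1)) : ℕ :=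
  Set.ncard {j | G.Adj i j}

/-- `d̄_i`: the number of neighbors of `i` smaller than `i`. -/
noncomputable def dbar (n : ℕ) (G : SimpleGraph (Fin (n+1))) (i : Fin (n+1)) : ℕ :=
  Set.ncard {j | j < i ∧ G.Adj i j}

/-- A `G`-parking function, encoded as `P : Fin (n+1) → ℕ` with `P 0 = 0`. -/
def IsParking (n : ℕ) (G : SimpleGraph (Fin (n+1))) (P : Fin (n+1) → ℕ) : Prop :=
  P 0 = 0 ∧ ∀ S : Finset (Fin (n+1)), S.Nonempty → (0 : Fin (n+1)) ∉ S →
    ∃ i ∈ S, P i < Set.ncard {j | j ∉ S ∧ G.Adj i j}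

/-- `codeg(P) = (|E(G)| - n) - Σ_{i=1}^n P(i)`. -/
noncomputable def codeg (n : ℕ) (G : SimpleGraph (Fin (n+1))) (P : Fin (n+1) → ℕ) : ℕ :=
  (Set.ncard G.edgeSet - n) - ∑ i, P i

/-- `[m]_q` as a Laurent polynomial. -/
noncomputable def lq (m : ℕ) : LaurentPolynomial ℤ :=
  ∑ k ∈ Finset.range m, LaurentPolynomial.T (k : ℤ)

/-- `[b]_{q^m} = 1 + q^m + ⋯ + q^{m(b-1)}` as a Laurent polynomial. -/
noncomputable def lqpow (m b : ℕ) : LaurentPolynomial ℤ :=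
  ∑ k ∈ Finset.range b, LaurentPolynomial.T ((m : ℤ) * k)

/-- `wt_{q,q⁻¹}(b)`: the substitution `t = q⁻¹` in `wt_{q,t}(b) = Σ_{k=0}^{b-1} q^k t^{b-1-k}`,
with `wt_{q,q⁻¹}(0) = 1`. -/
noncomputable def wtqq (b : ℕ) : LaurentPolynomial ℤ :=
  if b = 0 then 1 else ∑ k ∈ Finset.range b, LaurentPolynomial.T (2 * (k : ℤ) - ((b : ℤ) - 1))

/-- `Ehr_{q,q⁻¹}(F_G(a))`: the sum over all integer `a`-flows `f` of
`(-(1-q)(1-q⁻¹))^(s(f)-n) ∏_e wt_{q,q⁻¹}(f(e))`, as a Laurent polynomial in `q`. -/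
noncomputable def Ehrqq (n : ℕ) (G : SimpleGraph (Fin (n+1))) (a : Fin (n+1) → ℕ) :
    LaurentPolynomial ℤ :=
  ∑ᶠ f ∈ {f | IsFlow n G a f},
    (-((1 - LaurentPolynomial.T 1) * (1 - LaurentPolynomial.T (-1)))) ^ (posCount n f - n) *
      ∏ i, ∏ j, wtqq (f i j)

end ThresholdFlow

namespace ThresholdFlow

open LaurentPolynomial in
/-- Abbreviation for the coefficient ring. -/
abbrev LR := LaurentPolynomial ℤ

/-- The power `q^k`, `k : ℤ`. -/
noncomputable abbrev tq (k : ℤ) : LR := LaurentPolynomial.T k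

lemma tq_add (a b : ℤ) : tq (a + b) = tq a * tq b := LaurentPolynomial.T_add a b
lemma tq_zero : tq 0 = 1 := LaurentPolynomial.T_zero

lemma tq_sub_one_ne {k : ℤ} (hk : k ≠ 0) : tq k - 1 ≠ 0 := by
  intro h
  have h1 : tq k = tq 0 := by rw [tq_zero]; exact sub_eq_zero.mp h
  have h2 : (tq k).coeff k = (tq 0).coeff k := by rw [h1]
  rw [LaurentPolynomial.T_apply, LaurentPolynomial.T_apply, if_pos rfl, if_neg hk.symm] at h2
  exact one_ne_zero h2

/-- The scalar `M = -(1-q)(1-q⁻¹)`. -/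
noncomputable def Mq : LR := -((1 - tq 1) * (1 - tq (-1)))

lemma Mq_eq : Mq = tq (-1) * (tq 1 - 1) ^ 2 := by
  have h : tq (-1) * tq 1 = 1 := by rw [← tq_add]; exact tq_zero
  rw [Mq]; linear_combination (1 - tq 1) * h

/-- Weight `W 0 = 1`, `W c = M wt(c)`. -/
noncomputable def Wq (c : ℕ) : LR := if c = 0 then 1 else Mq * wtqq c

/-- The sum without the special case at zero. -/
noncomputable def uq (b : ℕ) : LR := ∑ k ∈ Finset.range b, tq (2 * (k : ℤ) - ((b : ℤ) - 1))

lemma uq_succ (b : ℕ) : uq (b+1) = tq 1 * uq b + tq (-b) := by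
  rw [uq, Finset.sum_range_succ', uq, Finset.mul_sum]
  congr 1
  · apply Finset.sum_congr rfl
    intro k _
    rw [← tq_add]
    congr 1
    push_cast; ring
  · congr 1
    push_cast; ring

lemma uq_rec (b : ℕ) : uq (b+2) = (tq 1 + tq (-1)) * uq (b+1) - uq b := by
  have h1 := uq_succ (b+1)
  have h2 := uq_succ b
  have h : tq (-1) * tq 1 = 1 := by rw [← tq_add]; exact tq_zero
  have h3 : tq (-((b+1 : ℕ) : ℤ)) = tq (-1) * tq (-(b:ℤ)) := by
    rw [← tq_add]; congr 1; push_cast; ring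
  rw [h3] at h1
  linear_combination h1 - tq (-1) * h2 - uq b * h

lemma uq_zero : uq 0 = 0 := by simp [uq]
lemma uq_one : uq 1 = 1 := by simp [uq]

lemma Wq_zero : Wq 0 = 1 := by simp [Wq]
lemma Wq_succ (c : ℕ) : Wq (c+1) = Mq * uq (c+1) := by simp [Wq, wtqq, uq]

lemma ps_key (f : ℕ → LR) (α β γ δ k : LR) (h0 : f 0 = k) (h1 : f 1 - (α+β) * f 0 = -(γ+δ)*k)
    (h2 : f 2 - (α+β) * f 1 + α * β * f 0 = γ * δ * k)
    (h3 : ∀ c, f (c+3) - (α+β) * f (c+2) + α * β * f (c+1) = 0) :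
    PowerSeries.mk f * ((1 - PowerSeries.C α * PowerSeries.X) * (1 - PowerSeries.C β * PowerSeries.X)) =
    PowerSeries.C k * ((1 - PowerSeries.C γ * PowerSeries.X) * (1 - PowerSeries.C δ * PowerSeries.X)) := by
  have e1 : PowerSeries.mk f * ((1 - PowerSeries.C α * PowerSeries.X) * (1 - PowerSeries.C β * PowerSeries.X)) = PowerSeries.mk f - PowerSeries.C (α+β) * (PowerSeries.mk f * PowerSeries.X)
      + PowerSeries.C (α * β) * (PowerSeries.mk f * PowerSeries.X * PowerSeries.X) := by
    simp only [map_add, map_mul]; ring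
  have e2 : PowerSeries.C k * ((1 - PowerSeries.C γ * PowerSeries.X) * (1 - PowerSeries.C δ * PowerSeries.X)) = PowerSeries.C k - PowerSeries.C ((γ+δ)*k) * (1 * PowerSeries.X)
      + PowerSeries.C (γ * δ * k) * (1 * PowerSeries.X * PowerSeries.X) := by
    simp only [map_add, map_mul]; ring
  rw [e1, e2]
  clear e1 e2
  generalize α + β = s at *
  generalize γ + δ = t at *
  ext1 c
  rcases c with _ | _ | _ | c
  · simp [h0]
  · simp only [map_add, map_sub, PowerSeries.coeff_C_mul, PowerSeries.coeff_succ_mul_X, PowerSeries.coeff_mk, PowerSeries.coeff_C, PowerSeries.coeff_one, PowerSeries.coeff_zero_mul_X]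
    simp
    linear_combination h1
  · simp only [map_add, map_sub, PowerSeries.coeff_C_mul, PowerSeries.coeff_succ_mul_X, PowerSeries.coeff_mk, PowerSeries.coeff_C, PowerSeries.coeff_one, PowerSeries.coeff_zero_mul_X]
    simp
    linear_combination h2
  · simp only [map_add, map_sub, PowerSeries.coeff_C_mul, PowerSeries.coeff_succ_mul_X, PowerSeries.coeff_mk, PowerSeries.coeff_C, PowerSeries.coeff_one, PowerSeries.coeff_zero_mul_X]
    simp
    linear_combination h3 c

/-- `1 - q^k x`. -/
noncomputable def lin (k : ℤ) : PowerSeries LR := 1 - PowerSeries.C (tq k) * PowerSeries.X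

lemma lin_ne (k : ℤ) : lin k ≠ 0 := by
  intro h
  have := congrArg (PowerSeries.coeff 0) h
  simp [lin] at this

/-- Generating function of weights, `x` scaled by `q^y`. -/
noncomputable def Gq (y : ℤ) : PowerSeries LR := PowerSeries.mk fun c => Wq c * tq (y * c)

lemma Gq_eq (y : ℤ) : Gq y * (lin (y+1) * lin (y-1)) = lin y * lin y := by
  have h : tq (-1) * tq 1 = 1 := by rw [← tq_add]; exact tq_zero
  have := ps_key (fun c => Wq c * tq (y * c)) (tq (y+1)) (tq (y-1)) (tq y) (tq y) 1 ?_ ?_ ?_ ?_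
  · simpa [lin, Gq] using this
  · simp [Wq_zero, tq]
  · rw [sub_eq_add_neg y 1, tq_add, tq_add]
    have hw : Wq 1 = Mq := by rw [← zero_add 1, Wq_succ 0, zero_add, uq_one, mul_one]
    simp only [Wq_zero, hw, Mq]
    simp only [Nat.cast_zero, Nat.cast_one, mul_zero, mul_one, zero_add, tq_zero]
    linear_combination -tq y * h
  · have e : tq (y * ((2:ℕ):ℤ)) = tq y * tq y := by rw [← tq_add]; congr 1; push_cast; ring
    simp only [e]
    rw [sub_eq_add_neg y 1, tq_add, tq_add]
    have hu := uq_rec 0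
    simp only [zero_add, uq_one, uq_zero] at hu
    simp only [Wq_zero, Wq_succ 0, Wq_succ 1, Mq, zero_add, uq_one, hu, one_add_one_eq_two]
    simp only [Nat.cast_zero, Nat.cast_one, mul_zero, mul_one, tq_zero]
    linear_combination tq y * tq y * h
  · intro c
    have e3 : tq (y * ((c+3:ℕ):ℤ)) = tq y * tq y * tq y * tq (y * c) := by
      simp only [← tq_add]; congr 1; push_cast; ring
    have e2 : tq (y * ((c+2:ℕ):ℤ)) = tq y * tq y * tq (y * c) := by
      simp only [← tq_add]; congr 1; push_cast; ring
    have e1 : tq (y * ((c+1:ℕ):ℤ)) = tq y * tq (y * c) := by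
      simp only [← tq_add]; congr 1; push_cast; ring
    simp only [e1, e2, e3]
    rw [sub_eq_add_neg y 1, tq_add, tq_add]
    have hu := uq_rec (c+1)
    simp only [Wq_succ, show c + 1 + 1 = c + 2 from rfl, show c + 1 + 2 = c + 3 from rfl] at hu ⊢
    rw [hu]
    linear_combination (Mq * uq (c+1) * tq y * tq y * tq y * tq (y * c)) * h

lemma coeff_tele (P m : ℤ) (H : PowerSeries LR)
    (hH : H * (lin (P+1) * lin (-(m+1))) = lin P * lin (-m)) (c : ℕ) (hc : 0 < c) :
    (tq (P+m+2) - 1) * PowerSeries.coeff c H =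
      (tq 1 - 1) * (tq (P+m+1) - 1) * (tq ((P+1) * c) - tq (-(m+1) * c)) := by
  have hK := ps_key (fun c => if c = 0 then tq (P+m+2) - 1 else
      (tq 1 - 1) * (tq (P+m+1) - 1) * (tq ((P+1) * c) - tq (-(m+1) * c)))
    (tq (P+1)) (tq (-(m+1))) (tq P) (tq (-m)) (tq (P+m+2)-1) ?_ ?_ ?_ ?_
  · have : PowerSeries.mk (fun c : ℕ => if c = 0 then tq (P+m+2) - 1 else
      (tq 1 - 1) * (tq (P+m+1) - 1) * (tq ((P+1) * c) - tq (-(m+1) * c))) = PowerSeries.C (tq (P+m+2)-1) * H := by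
      apply mul_right_cancel₀ (mul_ne_zero (lin_ne (P+1)) (lin_ne (-(m+1))))
      rw [mul_assoc, hH]
      exact hK
    have h2 := congrArg (PowerSeries.coeff c) this
    rw [PowerSeries.coeff_mk, PowerSeries.coeff_C_mul, if_neg hc.ne'] at h2
    exact h2.symm
  · simp
  · simp only [one_ne_zero, if_true, if_false, Nat.cast_one, mul_one]
    simp only [mul_sub, sub_mul, mul_add, add_mul, neg_mul, ← tq_add, one_mul, mul_one]
    ring_nf
  · simp only [one_ne_zero, two_ne_zero, if_true, if_false, Nat.cast_one, mul_one, Nat.cast_ofNat]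
    simp only [mul_sub, sub_mul, mul_add, add_mul, neg_mul, ← tq_add, one_mul, mul_one]
    ring_nf
  · intro c
    simp only [Nat.add_eq_zero_iff, OfNat.ofNat_ne_zero, one_ne_zero, and_false, if_false]
    have e3 (z : ℤ) : tq (z * ((c+3:ℕ):ℤ)) = tq z * tq z * tq z * tq (z * c) := by
      simp only [← tq_add]; congr 1; push_cast; ring
    have e2 (z : ℤ) : tq (z * ((c+2:ℕ):ℤ)) = tq z * tq z * tq (z * c) := by
      simp only [← tq_add]; congr 1; push_cast; ring
    have e1 (z : ℤ) : tq (z * ((c+1:ℕ):ℤ)) = tq z * tq (z * c) := by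
      simp only [← tq_add]; congr 1; push_cast; ring
    simp only [e1, e2, e3]
    ring

/-- Signed sum over the `2^n` sign patterns. -/
noncomputable def Phi : (n : ℕ) → ((Fin (n+1) → ℤ) → ℤ → ℤ → LR) → LR
  | 0, F => F (fun _ => 0) 0 0
  | n+1, F => Phi n fun y P m =>
      F (Fin.snoc (α := fun _ => ℤ) y (P+1)) (P+1) m - F (Fin.snoc (α := fun _ => ℤ) y (-(m+1))) P (m+1)

lemma Phi_mul (n : ℕ) (k : LR) (F) : Phi n (fun y P m => k * F y P m) = k * Phi n F := by
  induction n with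
  | zero => rfl
  | succ n ih =>
    simp only [Phi, ← mul_sub]
    rw [ih]

lemma Phi_sum {ι : Type*} (s : Finset ι) (n : ℕ) (F : ι → (Fin (n+1) → ℤ) → ℤ → ℤ → LR) :
    Phi n (fun y P m => ∑ c ∈ s, F c y P m) = ∑ c ∈ s, Phi n (F c) := by
  induction n with
  | zero => rfl
  | succ n ih =>
    simp only [Phi, ← Finset.sum_sub_distrib]
    rw [ih]

lemma Phi_congr (n : ℕ) (F G : (Fin (n+1) → ℤ) → ℤ → ℤ → LR)
    (h : ∀ (y : Fin (n+1) → ℤ) (P m : ℤ), P + m = n →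
      (∏ i, Gq (y i)) * (lin (P+1) * lin (-(m+1))) = lin P * lin (-m) → F y P m = G y P m) :
    Phi n F = Phi n G := by
  induction n with
  | zero =>
    apply h
    · simp
    · have := Gq_eq 0
      simpa using this
  | succ n ih =>
    simp only [Phi]
    apply ih
    intro y P m hPm hH
    congr 1
    · apply h
      · push_cast; linarith
      · rw [Fin.prod_univ_castSucc]
        simp only [Fin.snoc_castSucc, Fin.snoc_last]
        have hG := Gq_eq (P+1)
        rw [add_sub_cancel_right] at hG
        apply mul_right_cancel₀ (mul_ne_zero (lin_ne (P+1)) (lin_ne P))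
        linear_combination hG * (lin (P+1) * lin (-(m+1)) * ∏ i, Gq (y i)) + lin (P+1) ^ 2 * hH
    · apply h
      · push_cast; linarith
      · rw [Fin.prod_univ_castSucc]
        simp only [Fin.snoc_castSucc, Fin.snoc_last]
        have hG := Gq_eq (-(m+1))
        rw [show -(m+1)+1 = -m by ring, show -(m+1)-1 = -(m+1+1) by ring] at hG
        apply mul_right_cancel₀ (mul_ne_zero (lin_ne (-(m+1))) (lin_ne (-m)))
        linear_combination hG * (lin (P+1) * lin (-(m+1)) * ∏ i, Gq (y i)) + lin (-(m+1)) ^ 2 * hH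

/-- Extend a flow by a new top vertex with outgoing flow `c`. -/
def extF {n : ℕ} (c : Fin (n+1) → ℕ) (f : Fin (n+1) → Fin (n+1) → ℕ) :
    Fin (n+2) → Fin (n+2) → ℕ :=
  Fin.snoc (α := fun _ => Fin (n+2) → ℕ) (fun i => Fin.snoc (α := fun _ => ℕ) (f i) 0)
    (Fin.snoc (α := fun _ => ℕ) c 0)

lemma extF_cc {n : ℕ} (c : Fin (n+1) → ℕ) (f) (i j : Fin (n+1)) :
    extF c f i.castSucc j.castSucc = f i j := by simp [extF]
lemma extF_cl {n : ℕ} (c : Fin (n+1) → ℕ) (f) (i : Fin (n+1)) :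
    extF c f i.castSucc (Fin.last _) = 0 := by simp [extF]
lemma extF_lc {n : ℕ} (c : Fin (n+1) → ℕ) (f) (i : Fin (n+1)) :
    extF c f (Fin.last _) i.castSucc = c i := by simp [extF]
lemma extF_ll {n : ℕ} (c : Fin (n+1) → ℕ) (f) :
    extF c f (Fin.last _) (Fin.last _) = 0 := by simp [extF]

open Classical in
/-- The finset of all flows on the complete graph. -/
noncomputable def Fl : (n : ℕ) → (Fin (n+1) → ℕ) → Finset (Fin (n+1) → Fin (n+1) → ℕ)
  | 0, _ => {fun _ _ => 0}
  | n+1, a =>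
    (((Finset.univ : Finset (Fin (n+1))).finsuppAntidiag (a (Fin.last (n+1)))).sigma
      fun c => Fl n (fun i => a i.castSucc + c i)).image fun p => extF p.1 p.2

lemma mem_Fl (n : ℕ) (a : Fin (n+1) → ℕ) (f) : f ∈ Fl n a ↔ IsFlow n ⊤ a f := by
  induction n with
  | zero =>
    simp only [Fl, Finset.mem_singleton, IsFlow]
    constructor
    · rintro rfl
      refine ⟨by simp, fun i hi => absurd (Subsingleton.elim (α := Fin 1) i 0) hi⟩
    · rintro ⟨h, -⟩
      funext i j
      by_contra hne
      have := (h i j hne).1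
      rw [Subsingleton.elim (α := Fin 1) i j] at this
      exact lt_irrefl _ this
  | succ n ih =>
    simp only [Fl, Finset.mem_image, Finset.mem_sigma, ih, Finset.mem_finsuppAntidiag]
    constructor
    · rintro ⟨⟨c, g⟩, ⟨⟨hc, -⟩, hg1, hg2⟩, rfl⟩
      dsimp only at hc hg1 hg2 ⊢
      constructor
      · intro i j
        induction i using Fin.lastCases with
        | last =>
          induction j using Fin.lastCases with
          | last => simp [extF_ll]
          | cast j => intro _; simp [Fin.castSucc_lt_last, (Fin.castSucc_lt_last j).ne']
        | cast i =>
          induction j using Fin.lastCases with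
          | last => simp [extF_cl]
          | cast j =>
            rw [extF_cc]
            intro h
            have := (hg1 i j h).1
            simp [this, this.ne']
      · intro i
        induction i using Fin.lastCases with
        | last =>
          intro _
          simp only [Fin.sum_univ_castSucc (n := n+1)]
          simp [extF_ll, extF_cl, extF_lc, hc]
        | cast i =>
          intro hi
          have hi' : i ≠ 0 := by rintro rfl; exact hi rfl
          have := hg2 i hi'
          simp only [Fin.sum_univ_castSucc (n := n+1), extF_cc, extF_cl, extF_lc, this]
          ring
    · rintro ⟨h1, h2⟩
      have hz : ∀ i, f i (Fin.last (n+1)) = 0 := by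
        intro i
        by_contra hne
        exact absurd (h1 _ _ hne).1 (not_lt.mpr (Fin.le_last i))
      refine ⟨⟨Finsupp.equivFunOnFinite.symm (fun j => f (Fin.last (n+1)) j.castSucc), fun i j => f i.castSucc j.castSucc⟩, ⟨⟨?_, by simp⟩, ?_, ?_⟩, ?_⟩
      · have := h2 (Fin.last (n+1)) (Fin.last_pos.ne')
        rw [Fin.sum_univ_castSucc] at this
        simpa [hz] using this
      · intro i j h
        have := (h1 _ _ h).1
        rw [Fin.castSucc_lt_castSucc_iff] at this
        simp [this, this.ne']
      · intro i hi
        have := h2 i.castSucc (by rwa [Ne, Fin.castSucc_eq_zero_iff])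
        simp only [Fin.sum_univ_castSucc (n := n+1), hz] at this
        simp
        omega
      · funext i j
        induction i using Fin.lastCases with
        | last =>
          induction j using Fin.lastCases with
          | last => simp [extF_ll, hz]
          | cast j => simp [extF_lc]
        | cast i =>
          induction j using Fin.lastCases with
          | last => simp [extF_cl, hz]
          | cast j => simp [extF_cc]

lemma extF_inj {n : ℕ} (c c' : Fin (n+1) → ℕ) (f f') (h : extF c f = extF c' f') :
    c = c' ∧ f = f' := by
  constructor
  · funext i
    have := congrFun (congrFun h (Fin.last _)) i.castSucc
    simpa [extF_lc] using this
  · funext i j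
    have := congrFun (congrFun h i.castSucc) j.castSucc
    simpa [extF_cc] using this

/-- Total weight. -/
noncomputable def Sq (n : ℕ) (a : Fin (n+1) → ℕ) : LR :=
  ∑ f ∈ Fl n a, ∏ i, ∏ j, Wq (f i j)

lemma Sq_succ (n : ℕ) (a : Fin (n+2) → ℕ) :
    Sq (n+1) a = ∑ c ∈ (Finset.univ : Finset (Fin (n+1))).finsuppAntidiag (a (Fin.last (n+1))),
      (∏ i, Wq (c i)) * Sq n (fun i => a i.castSucc + c i) := by
  rw [Sq, Fl, Finset.sum_image, Finset.sum_sigma]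
  · apply Finset.sum_congr rfl
    intro c _
    rw [Sq, Finset.mul_sum]
    apply Finset.sum_congr rfl
    intro f _
    rw [Fin.prod_univ_castSucc]
    simp only [Fin.prod_univ_castSucc (n := n+1), extF_cc, extF_cl, extF_lc, extF_ll, Wq_zero, mul_one]
    ring
  · rintro ⟨c, f⟩ _ ⟨c', f'⟩ _ h
    obtain ⟨h1, rfl⟩ := extF_inj _ _ _ _ h
    obtain rfl := DFunLike.coe_injective h1
    rfl

lemma Sq_eq (n : ℕ) (a : Fin (n+1) → ℕ) (ha : ∀ i, i ≠ 0 → 0 < a i) :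
    (tq (n+1) - 1) * Sq n a =
      (tq 1 - 1) ^ (n+1) * Phi n (fun y _ _ => ∏ i, tq (y i * a i)) := by
  induction n with
  | zero => simp [Sq, Fl, Phi, Wq_zero]
  | succ n ih =>
    have hne : tq ((n:ℤ)+1) - 1 ≠ 0 := tq_sub_one_ne (by omega)
    apply mul_left_cancel₀ hne
    have hpos : 0 < a (Fin.last (n+1)) := ha _ Fin.last_pos.ne'
    rw [Sq_succ]
    calc _ = (tq ((n:ℤ)+2) - 1) * ∑ c ∈ (Finset.univ : Finset (Fin (n+1))).finsuppAntidiag (a (Fin.last (n+1))),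
              (∏ i, Wq (c i)) * ((tq 1 - 1) ^ (n+1) * Phi n (fun y _ _ => ∏ i, tq (y i * (a i.castSucc + c i : ℕ)))) := by
            rw [show (((n+1:ℕ):ℤ)+1) = (n:ℤ)+2 by push_cast; ring, mul_left_comm]
            congr 1
            rw [Finset.mul_sum]
            apply Finset.sum_congr rfl
            intro c _
            rw [← ih]
            · ring
            · intro i hi
              have := ha i.castSucc (by rwa [Ne, Fin.castSucc_eq_zero_iff])
              omega
      _ = (tq 1 - 1) ^ (n+1) * Phi n (fun y P m => (∏ i, tq (y i * (a i.castSucc : ℕ))) *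
            ((tq ((n:ℤ)+2) - 1) * PowerSeries.coeff (a (Fin.last (n+1))) (∏ i, Gq (y i)))) := by
          simp only [PowerSeries.coeff_prod, Finset.mul_sum]
          rw [Phi_sum, Finset.mul_sum]
          apply Finset.sum_congr rfl
          intro c _
          rw [mul_left_comm _ ((tq 1 - 1)^(n+1)), mul_left_comm _ ((tq 1 - 1)^(n+1)), ← Phi_mul, ← Phi_mul]
          congr 2
          funext y P m
          simp only [Gq, PowerSeries.coeff_mk, Finset.prod_mul_distrib, Nat.cast_add, mul_add, tq_add]
          ring
      _ = (tq 1 - 1) ^ (n+1) * Phi n (fun y P m => (tq 1 - 1) * (tq (n+1) - 1) * ((∏ i, tq (y i * (a i.castSucc : ℕ))) *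
            (tq ((P+1) * a (Fin.last (n+1))) - tq (-(m+1) * a (Fin.last (n+1)))))) := by
          congr 1
          apply Phi_congr
          intro y P m hPm hH
          have := coeff_tele P m _ hH _ hpos
          rw [hPm] at this
          rw [this]; ring
      _ = _ := by
          rw [Phi_mul, Phi]
          simp only [Fin.prod_univ_castSucc (n := n+1), Fin.snoc_castSucc, Fin.snoc_last, ← mul_sub]
          ring

lemma Phi_prod (n : ℕ) (a : Fin (n+1) → ℕ) (w : ℤ) :
    Phi n (fun y P _ => (∏ i, tq (y i * a i)) * tq (P * w)) =
      ∏ i : Fin n, tq (-((i:ℤ)+1) * a i.succ) *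
        (tq (((i:ℤ)+2) * a i.succ + (∑ j, if i.succ < j then (a j : ℤ) else 0) + w) - 1) := by
  induction n generalizing w with
  | zero => simp [Phi]
  | succ n ih =>
    have := ih (fun i => a i.castSucc) (a (Fin.last (n+1)) + w)
    rw [Fin.prod_univ_castSucc]
    rw [Phi]
    trans (tq (a (Fin.last (n+1)) + w) - tq (-((n:ℤ)+1) * a (Fin.last (n+1)))) * Phi n (fun y P _ => (∏ i, tq (y i * a i.castSucc)) * tq (P * (a (Fin.last (n+1)) + w)))
    · rw [← Phi_mul]
      apply Phi_congr
      intro y P m hPm _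
      simp only [Fin.prod_univ_castSucc (n := n+1), Fin.snoc_castSucc, Fin.snoc_last]
      obtain rfl : m = n - P := by linarith
      simp only [sub_mul]
      congr 1
      · rw [mul_assoc, ← tq_add, mul_left_comm, ← tq_add]; congr 2; ring
      · rw [mul_assoc, ← tq_add, mul_left_comm, ← tq_add]; congr 2; ring
    · rw [this, mul_comm]
      congr 1
      · apply Finset.prod_congr rfl
        intro i _
        rw [Fin.sum_univ_castSucc (n := n+1)]
        simp only [Fin.succ_castSucc, Fin.castSucc_lt_castSucc_iff, Fin.castSucc_lt_last, if_true, Fin.val_castSucc]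
        congr 3
        ring
      · rw [mul_sub, ← tq_add, Fin.succ_last]
        have : ∀ j : Fin (n+2), ¬ (Fin.last (n+1) < j) := fun j => not_lt.mpr (Fin.le_last j)
        simp only [this, if_false, Finset.sum_const_zero, Fin.val_last, mul_one]
        congr 2
        ring

lemma lq_mul (m : ℕ) : (tq 1 - 1) * lq m = tq m - 1 := by
  induction m with
  | zero => simp [lq, tq]
  | succ m ih =>
    have : lq (m+1) = lq m + tq m := by simp [lq, Finset.sum_range_succ]
    rw [this, mul_add, ih, Nat.cast_add, tq_add, Nat.cast_one]; ring

lemma lqpow_mul (k m : ℕ) : (tq k - 1) * lqpow k m = tq (k * m) - 1 := by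
  induction m with
  | zero => simp [lqpow, tq]
  | succ m ih =>
    have : lqpow k (m+1) = lqpow k m + tq (k*m) := by simp [lqpow, Finset.sum_range_succ]
    rw [this, mul_add, ih, Nat.cast_add, mul_add, tq_add, Nat.cast_one, mul_one]; ring

lemma tq_prod {ι : Type*} (s : Finset ι) (g : ι → ℤ) : ∏ i ∈ s, tq (g i) = tq (∑ i ∈ s, g i) := by
  classical
  induction s using Finset.induction_on with
  | empty => simp [tq]
  | insert i s hi ih => rw [Finset.prod_insert hi, Finset.sum_insert hi, tq_add, ih]

lemma posCount_ge (n : ℕ) (a : Fin (n+1) → ℕ) (ha : ∀ i, i ≠ 0 → 0 < a i) (f)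
    (hf : IsFlow n ⊤ a f) : n ≤ posCount n f := by
  have : ∀ i : Fin n, ∃ j, 0 < f i.succ j := by
    intro i
    by_contra! h
    have h2 := hf.2 i.succ (Fin.succ_ne_zero i)
    have h3 := ha i.succ (Fin.succ_ne_zero i)
    have : ∑ j, f i.succ j = 0 := Finset.sum_eq_zero fun j _ => Nat.le_zero.mp (h j)
    omega
  choose g hg using this
  have h := Finset.card_le_card_of_injOn (s := (Finset.univ : Finset (Fin n)))
    (t := Finset.univ.filter fun pr : Fin (n+1) × Fin (n+1) => 0 < f pr.1 pr.2)
    (fun i => (i.succ, g i)) (by intro i _; simp [hg]) (by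
      intro i _ j _ h
      exact Fin.succ_injective _ (Prod.mk.inj h).1)
  simpa [posCount] using h

lemma prod_Wq (n : ℕ) (f : Fin (n+1) → Fin (n+1) → ℕ) :
    ∏ i, ∏ j, Wq (f i j) = Mq ^ posCount n f * ∏ i, ∏ j, wtqq (f i j) := by
  have h : ∀ c, Wq c = (if 0 < c then Mq else 1) * wtqq c := by
    intro c
    rcases c with _ | c
    · simp [Wq, wtqq]
    · simp [Wq]
  simp only [h, Finset.prod_mul_distrib]
  congr 1
  rw [← Finset.prod_product', Finset.prod_ite, Finset.prod_const_one, Finset.prod_const, mul_one]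
  rfl

lemma Ehr_Sq (n : ℕ) (a : Fin (n+1) → ℕ) (ha : ∀ i, i ≠ 0 → 0 < a i) :
    Mq ^ n * Ehrqq n ⊤ a = Sq n a := by
  have hs : {f | IsFlow n ⊤ a f} = (Fl n a : Set _) := by
    ext f; simp [mem_Fl]
  rw [Ehrqq, hs, finsum_mem_coe_finset, Sq, Finset.mul_sum]
  apply Finset.sum_congr rfl
  intro f hf
  rw [prod_Wq, ← mul_assoc]
  congr 1
  have := posCount_ge n a ha f ((mem_Fl n a f).mp hf)
  change Mq ^ n * Mq ^ _ = _
  rw [← pow_add, Nat.add_sub_cancel' this]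

theorem ehr_qqinv_complete (n : ℕ) (hn : 1 ≤ n) (a : Fin (n+1) → ℕ)
    (ha : ∀ i : Fin (n+1), i ≠ 0 → 0 < a i) :
    Ehrqq n ⊤ a =
      LaurentPolynomial.T (-(((∑ i : Fin (n+1), (i : ℕ) * a i : ℕ) : ℤ) - n)) *
        lqpow (n+1) (a (Fin.last n)) *
        ∏ i ∈ Finset.univ.filter (fun i : Fin (n+1) => 0 < (i : ℕ) ∧ (i : ℕ) < n),
          lq (((i : ℕ) + 1) * a i + ∑ j : Fin (n+1), if i < j then a j else 0) := by
  obtain ⟨n, rfl⟩ : ∃ k, n = k + 1 := ⟨n - 1, by omega⟩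
  have h1 := Sq_eq (n+1) a ha
  have h2 := Phi_prod (n+1) a 0
  simp only [mul_zero, tq_zero, mul_one, add_zero] at h2
  rw [← Ehr_Sq _ a ha, h2, Finset.prod_mul_distrib, tq_prod, Fin.prod_univ_castSucc] at h1
  have hl : ∀ j : Fin (n+2), ¬ (Fin.last (n+1) < j) := fun j => not_lt.mpr (Fin.le_last j)
  have e1 : ∑ i : Fin (n+1), -((i:ℤ)+1) * a i.succ = -((∑ i : Fin (n+2), (i : ℕ) * a i : ℕ) : ℤ) := by
    rw [Fin.sum_univ_succ (n := n+1)]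
    push_cast
    simp only [Fin.val_zero, Nat.cast_zero, zero_mul, zero_add, Fin.val_succ, Nat.cast_add, Nat.cast_one, neg_mul, Finset.sum_neg_distrib]
  have e3 : ∏ i ∈ Finset.univ.filter (fun i : Fin (n+2) => 0 < (i : ℕ) ∧ (i : ℕ) < n+1),
          lq (((i : ℕ) + 1) * a i + ∑ j : Fin (n+2), if i < j then a j else 0)
      = ∏ i : Fin n, lq (((i : ℕ) + 2) * a i.castSucc.succ + ∑ j : Fin (n+2), if i.castSucc.succ < j then a j else 0) := by
    rw [Finset.prod_filter, Fin.prod_univ_succ, Fin.prod_univ_castSucc]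
    simp [add_assoc]
  have e4 : ∀ i : Fin n, tq ((((i.castSucc : Fin (n+1)) : ℕ) + 2 : ℤ) * a i.castSucc.succ + (∑ j, if i.castSucc.succ < j then (a j : ℤ) else 0)) - 1
      = (tq 1 - 1) * lq (((i : ℕ) + 2) * a i.castSucc.succ + ∑ j : Fin (n+2), if i.castSucc.succ < j then a j else 0) := by
    intro i
    rw [lq_mul]
    push_cast
    rfl
  have e5 := lqpow_mul (n+2) (a (Fin.last (n+1)))
  simp only [e4, Finset.prod_mul_distrib, Finset.prod_const, Finset.card_univ, Fintype.card_fin, e1, Fin.succ_last, hl, if_false,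
    Finset.sum_const_zero, add_zero, Fin.val_last] at h1
  rw [← e3] at h1
  push_cast at e5 h1
  rw [← e5] at h1
  have hM : Mq ^ (n+1) = tq (-((n:ℤ)+1)) * (tq 1 - 1) ^ (2 * (n+1)) := by
    rw [Mq_eq, mul_pow, ← pow_mul]
    congr 1
    rw [LaurentPolynomial.T_pow]; congr 1; push_cast; ring
  have hT : tq (-((n:ℤ)+1)) * tq ((n:ℤ)+1) = 1 := by rw [← tq_add, neg_add_cancel, tq_zero]
  have hne : (tq ((n:ℤ)+2) - 1) * (tq (-((n:ℤ)+1)) * (tq 1 - 1) ^ (2 * (n+1))) ≠ 0 := by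
    refine mul_ne_zero (tq_sub_one_ne (by omega)) (mul_ne_zero ?_ (pow_ne_zero _ (tq_sub_one_ne one_ne_zero)))
    exact left_ne_zero_of_mul (hT ▸ one_ne_zero)
  apply mul_left_cancel₀ hne
  rw [hM] at h1
  rw [show ((n:ℤ)+1+1) = n+2 by ring] at h1
  rw [mul_assoc, h1]
  push_cast
  have hE : ∀ s : ℤ, LaurentPolynomial.T (-(s - ((n:ℤ)+1))) = tq ((n:ℤ)+1) * tq (-s) := by
    intro s
    rw [← tq_add]; congr 1; ring
  rw [hE]
  linear_combination (-((tq 1 - 1) ^ (n + 1 + 1) * (tq (-∑ x : Fin (n+2), ((x : ℕ) : ℤ) * (a x : ℤ)) *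
    (((tq 1 - 1) ^ n * ∏ i ∈ Finset.univ.filter (fun i : Fin (n+2) => 0 < (i : ℕ) ∧ (i : ℕ) < n+1),
          lq (((i : ℕ) + 1) * a i + ∑ j : Fin (n+2), if i < j then a j else 0)) *
      ((tq ((n:ℤ) + 2) - 1) * lqpow (n + 2) (a (Fin.last (n + 1)))))))) * hT

end ThresholdFlow
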